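/- arXiv:1501.05457 — 4 statements merged into one kernel-verified Lean document; each statement's English description precedes it below -/
import Mathlib

section
/- The infinite series ∑_{n=1}^∞ (1/(3n−2) − 1/(3n−1)) converges and equals π/(3√3). -/
open Real

open Filter Topology in
/-- The Mittag-Leffler expansion of the cotangent at a real point. -/
theorem tendsto_sum_cot_of_not_int {x : ℝ} (hx : ∀ m : ℤ, (m : ℝ) ≠ x) :
    Tendsto (fun N : ℕ => ∑ j ∈ Finset.range N, (1 / (x - (j + 1)) + 1 / (x + (j + 1)))) atTop
      (𝓝 (π * Real.cot (π * x) - 1 / x)) := by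
  have hx' : (x : ℂ) ∈ Complex.integerComplement := by
    rintro ⟨m, hm⟩
    exact hx m (by exact_mod_cast hm)
  have h := tendsto_logDeriv_euler_cot_sub hx'
  simp only [cotTerm] at h
  rw [← tendsto_ofReal_iff]
  exact_mod_cast h

theorem Real.cot_pi_div_three : Real.cot (π / 3) = 1 / √3 := by
  rw [Real.cot_eq_cos_div_sin, Real.cos_pi_div_three, Real.sin_pi_div_three]
  field_simp

theorem sum_range_grouped_mod_three (N : ℕ) :
    ∑ n ∈ Finset.range N, (1 / (3 * ((n : ℝ) + 1) - 2) - 1 / (3 * ((n : ℝ) + 1) - 1)) =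
      (∑ j ∈ Finset.range N, (1 / ((1 / 3 : ℝ) - (j + 1)) + 1 / ((1 / 3 : ℝ) + (j + 1)))) / 3 +
        1 - 1 / (3 * (N : ℝ) + 1) := by
  induction N with
  | zero => simp
  | succ N ih =>
    rw [Finset.sum_range_succ, Finset.sum_range_succ, ih]
    have e1 : 1 / ((1 / 3 : ℝ) - (N + 1)) = -(3 * (1 / (3 * (N : ℝ) + 2))) := by
      rw [show (1 / 3 : ℝ) - (N + 1) = -((3 * (N : ℝ) + 2) / 3) by ring]
      field_simp
    have e2 : 1 / ((1 / 3 : ℝ) + (N + 1)) = 3 * (1 / (3 * (N : ℝ) + 4)) := by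
      rw [show (1 / 3 : ℝ) + (N + 1) = (3 * (N : ℝ) + 4) / 3 by ring]
      field_simp
    rw [e1, e2, show 3 * ((N : ℝ) + 1) - 2 = 3 * N + 1 by ring,
      show 3 * ((N : ℝ) + 1) - 1 = 3 * N + 2 by ring,
      show 3 * ((N + 1 : ℕ) : ℝ) + 1 = 3 * N + 4 by push_cast; ring]
    ring

theorem sum_grouped_mod_three_eq_pi_div_three_sqrt_three :
    HasSum (fun n : ℕ => 1 / (3 * ((n : ℝ) + 1) - 2) - 1 / (3 * ((n : ℝ) + 1) - 1))
      (Real.pi / (3 * Real.sqrt 3)) := by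
  rw [hasSum_iff_tendsto_nat_of_nonneg]
  · simp_rw [sum_range_grouped_mod_three]
    have h := tendsto_sum_cot_of_not_int (x := 1 / 3) fun m hm => by
      have h3 : (3 * m : ℝ) = 1 := by linarith
      have : 3 * m = 1 := by exact_mod_cast h3
      omega
    have hN : Filter.Tendsto (fun N : ℕ => 1 / (3 * (N : ℝ) + 1)) Filter.atTop (nhds 0) := by
      simp_rw [one_div]
      exact (Filter.tendsto_atTop_add_const_right _ _
        (tendsto_natCast_atTop_atTop.const_mul_atTop three_pos)).inv_tendsto_atTop
    convert! ((h.div_const 3).add_const 1).sub hN using 2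
    rw [mul_one_div, Real.cot_pi_div_three]
    field_simp
    ring
  · intro n
    have hn : (0 : ℝ) ≤ n := n.cast_nonneg
    exact sub_nonneg.2 (one_div_le_one_div_of_le (by linarith) (by linarith))
end

section
/- The infinite series ∑_{n=1}^∞ (1/(4n−3) − 1/(4n−2)) converges and equals (1/4)·log 2 + π/8. -/
open Real

open Filter Topology

theorem tendsto_harmonic_two_mul_sub_harmonic :
    Tendsto (fun n : ℕ => (harmonic (2 * n) : ℝ) - harmonic n) atTop (𝓝 (log 2)) := by
  have h := tendsto_harmonic_sub_log
  have h2 := h.comp (tendsto_id.const_mul_atTop' (show 0 < 2 by norm_num))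
  have h3 := (h2.sub h).add_const (log 2)
  rw [sub_self, zero_add] at h3
  refine h3.congr' ?_
  filter_upwards [eventually_ne_atTop 0] with n hn
  have hn' : (n : ℝ) ≠ 0 := Nat.cast_ne_zero.mpr hn
  simp only [Function.comp_apply, id, Nat.cast_mul, Nat.cast_ofNat, log_mul two_ne_zero hn']
  ring

theorem sum_range_grouped_mod_four_eq (N : ℕ) :
    ∑ n ∈ Finset.range N, (1 / (4 * ((n : ℝ) + 1) - 3) - 1 / (4 * ((n : ℝ) + 1) - 2)) =
      1 / 2 * ∑ i ∈ Finset.range (2 * N), (-1 : ℝ) ^ i / (2 * i + 1) +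
        1 / 2 * ((harmonic (2 * (2 * N)) : ℝ) - harmonic (2 * N)) -
        1 / 4 * ((harmonic (2 * N) : ℝ) - harmonic N) := by
  induction N with
  | zero => simp
  | succ N ih =>
    have e4 : 2 * (2 * (N + 1)) = 2 * (2 * N) + 1 + 1 + 1 + 1 := by ring
    have e2 : 2 * (N + 1) = 2 * N + 1 + 1 := by ring
    rw [Finset.sum_range_succ, ih, e4, e2]
    simp only [Finset.sum_range_succ, harmonic_succ, pow_succ, pow_mul]
    push_cast
    have h1 : 4 * ((N : ℝ) + 1) - 3 = 4 * N + 1 := by ring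
    have h2 : 4 * ((N : ℝ) + 1) - 2 = 2 * (2 * N + 1) := by ring
    rw [h1, h2]
    norm_num
    field_simp
    ring

theorem sum_grouped_mod_four_eq_quarter_log_two_add_pi_div_eight :
    HasSum (fun n : ℕ => 1 / (4 * ((n : ℝ) + 1) - 3) - 1 / (4 * ((n : ℝ) + 1) - 2))
      ((1 / 4) * Real.log 2 + Real.pi / 8) := by
  have hnonneg (n : ℕ) :
      (0 : ℝ) ≤ 1 / (4 * ((n : ℝ) + 1) - 3) - 1 / (4 * ((n : ℝ) + 1) - 2) := by
    have hn : (0 : ℝ) ≤ n := n.cast_nonneg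
    exact sub_nonneg.mpr (one_div_le_one_div_of_le (by linarith) (by linarith))
  rw [hasSum_iff_tendsto_nat_of_nonneg hnonneg]
  simp only [sum_range_grouped_mod_four_eq]
  have hdouble : Tendsto (fun N : ℕ => 2 * N) atTop atTop :=
    tendsto_id.const_mul_atTop' (show 0 < 2 by norm_num)
  have hleibniz := (tendsto_sum_pi_div_four.comp hdouble).const_mul (1 / 2)
  have hlog := tendsto_harmonic_two_mul_sub_harmonic
  have hvalue : 1 / 4 * log 2 + π / 8 =
      1 / 2 * (π / 4) + 1 / 2 * log 2 - 1 / 4 * log 2 := by ring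
  rw [hvalue]
  exact (hleibniz.add ((hlog.comp hdouble).const_mul (1 / 2))).sub (hlog.const_mul (1 / 4))
end

section
/- The infinite series ∑_{n=1}^∞ (1/(5n−4) − 1/(5n−1)) converges and equals (1+√5)·π / (5·√(2·(5−√5))). -/
open Real

/-- The Mittag-Leffler expansion of the cotangent on `(0, 1)`, with the terms of the two
half-lines of integers paired so that each summand has the sign of `1 - 2 * x`. -/
theorem hasSum_one_div_add_sub_one_div_add_one_sub {x : ℝ} (hx₀ : 0 < x) (hx₁ : x < 1) :
    HasSum (fun n : ℕ => 1 / ((n : ℝ) + x) - 1 / ((n : ℝ) + 1 - x)) (π * Real.cot (π * x)) := by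
  have hx : (x : ℂ) ∈ Complex.integerComplement := by
    rw [Complex.mem_integerComplement_iff]
    rintro ⟨m, hm⟩
    have hm : (m : ℝ) = x := by exact_mod_cast hm
    have h₀ : 0 < m := by exact_mod_cast hm ▸ hx₀
    have h₁ : m < 1 := by exact_mod_cast hm ▸ hx₁
    omega
  have hcot : HasSum (fun n : ℕ => 1 / (x - ((n : ℝ) + 1)) + 1 / (x + ((n : ℝ) + 1)))
      (π * Real.cot (π * x) - 1 / x) := by
    have h := (summable_cotTerm hx).hasSum
    have hrep := cot_series_rep' hx
    simp only [cotTerm] at h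
    rw [← hrep] at h
    exact_mod_cast h
  have htel : HasSum (fun n : ℕ => 1 / ((n : ℝ) + x) - 1 / (((n + 1 : ℕ) : ℝ) + x)) (1 / x) := by
    rw [hasSum_iff_tendsto_nat_of_nonneg]
    · simp only [Finset.sum_range_sub' (fun n : ℕ => 1 / ((n : ℝ) + x))]
      have h : Filter.Tendsto (fun n : ℕ => 1 / ((n : ℝ) + x)) Filter.atTop (nhds 0) := by
        simpa only [one_div, Function.comp_def] using tendsto_inv_atTop_zero.comp
          (Filter.tendsto_atTop_add_const_right _ x tendsto_natCast_atTop_atTop)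
      simpa using h.const_sub (1 / x)
    · intro n
      rw [sub_nonneg]
      push_cast
      gcongr
      linarith
  convert hcot.add htel using 1
  · funext n
    have hneg : 1 / (x - ((n : ℝ) + 1)) = -(1 / ((n : ℝ) + 1 - x)) := by
      rw [← neg_sub, one_div_neg_eq_neg_one_div]
    rw [hneg]
    push_cast
    ring
  · ring

theorem sin_pi_div_five : sin (π / 5) = √(2 * (5 - √5)) / 4 := by
  have h₅ : √5 ^ 2 = 5 := Real.sq_sqrt (by norm_num)
  have hpos : 0 ≤ sin (π / 5) :=
    sin_nonneg_of_nonneg_of_le_pi (by positivity) (by linarith [pi_pos])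
  have hsq : 2 * (5 - √5) = (4 * sin (π / 5)) ^ 2 := by
    rw [mul_pow, sin_sq, cos_pi_div_five]
    linarith
  rw [hsq, Real.sqrt_sq (by positivity)]
  ring

theorem sum_grouped_mod_five_eq :
    HasSum (fun n : ℕ => 1 / (5 * ((n : ℝ) + 1) - 4) - 1 / (5 * ((n : ℝ) + 1) - 1))
      ((1 + Real.sqrt 5) * Real.pi / (5 * Real.sqrt (2 * (5 - Real.sqrt 5)))) := by
  have h := (hasSum_one_div_add_sub_one_div_add_one_sub (x := 1 / 5)
    (by norm_num) (by norm_num)).mul_left (1 / 5)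
  have hval : (1 + √5) * π / (5 * √(2 * (5 - √5))) = 1 / 5 * (π * Real.cot (π * (1 / 5))) := by
    rw [mul_one_div, Real.cot_eq_cos_div_sin, cos_pi_div_five, sin_pi_div_five,
      div_div_div_cancel_right₀ (by norm_num)]
    ring
  rw [hval]
  refine h.congr_fun fun n => ?_
  rw [mul_sub, one_div_mul_one_div, one_div_mul_one_div]
  congr 2 <;> ring
end

section
/- The infinite series ∑_{n=1}^∞ (1/(8n−7) − 1/(8n−3)) converges and equals (π + log(3 + 2√2)) / (4√2). -/
open Real

lemma one_add_pow_four_pos (x : ℝ) : 0 < 1 + x ^ 4 := by positivity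

lemma intervalIntegrable_pow_div_one_add_pow_four (k : ℕ) (a b : ℝ) :
    IntervalIntegrable (fun x : ℝ => x ^ k / (1 + x ^ 4)) MeasureTheory.volume a b :=
  (Continuous.div (by fun_prop) (by fun_prop)
    fun x => (one_add_pow_four_pos x).ne').intervalIntegrable a b

/-- Reduction formula for the integrals of `x ^ k / (1 + x ^ 4)` over the unit interval. -/
lemma integral_pow_div_one_add_pow_four_sub (k : ℕ) :
    (∫ x in (0 : ℝ)..1, x ^ k / (1 + x ^ 4)) - ∫ x in (0 : ℝ)..1, x ^ (k + 8) / (1 + x ^ 4) =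
      1 / ((k : ℝ) + 1) - 1 / ((k : ℝ) + 5) := by
  rw [← intervalIntegral.integral_sub (intervalIntegrable_pow_div_one_add_pow_four k 0 1)
    (intervalIntegrable_pow_div_one_add_pow_four (k + 8) 0 1)]
  have h (x : ℝ) : x ^ k / (1 + x ^ 4) - x ^ (k + 8) / (1 + x ^ 4) = x ^ k - x ^ (k + 4) := by
    have := (one_add_pow_four_pos x).ne'
    field_simp
    ring
  simp_rw [h]
  rw [intervalIntegral.integral_sub (by simp) (by simp), integral_pow, integral_pow]
  push_cast
  simp only [one_pow, ne_eq, Nat.add_eq_zero_iff, one_ne_zero, and_false, not_false_eq_true,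
    zero_pow, sub_zero]
  ring_nf

lemma integral_pow_div_one_add_pow_four_nonneg (k : ℕ) :
    0 ≤ ∫ x in (0 : ℝ)..1, x ^ k / (1 + x ^ 4) :=
  intervalIntegral.integral_nonneg zero_le_one fun x hx =>
    div_nonneg (pow_nonneg hx.1 k) (one_add_pow_four_pos x).le

lemma integral_pow_div_one_add_pow_four_le (k : ℕ) :
    ∫ x in (0 : ℝ)..1, x ^ k / (1 + x ^ 4) ≤ 1 / ((k : ℝ) + 1) := by
  calc ∫ x in (0 : ℝ)..1, x ^ k / (1 + x ^ 4)
      ≤ ∫ x in (0 : ℝ)..1, x ^ k := by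
        refine intervalIntegral.integral_mono_on zero_le_one
          (intervalIntegrable_pow_div_one_add_pow_four k 0 1) (by simp) fun x hx => ?_
        exact div_le_self (pow_nonneg hx.1 k) (by linarith [pow_nonneg hx.1 4])
    _ = 1 / ((k : ℝ) + 1) := by simp [integral_pow]

lemma sq_add_sqrt_two_mul_add_one_pos (x : ℝ) : 0 < x ^ 2 + √2 * x + 1 := by
  nlinarith [sq_nonneg (√2 * x + 1), Real.sq_sqrt (zero_le_two (α := ℝ))]

lemma sq_sub_sqrt_two_mul_add_one_pos (x : ℝ) : 0 < x ^ 2 - √2 * x + 1 := by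
  nlinarith [sq_nonneg (√2 * x - 1), Real.sq_sqrt (zero_le_two (α := ℝ))]

lemma hasDerivAt_antideriv_one_div_one_add_pow_four (x : ℝ) :
    HasDerivAt (fun x : ℝ => (log (x ^ 2 + √2 * x + 1) - log (x ^ 2 - √2 * x + 1)
      + 2 * (arctan (√2 * x + 1) + arctan (√2 * x - 1))) / (4 * √2)) (1 / (1 + x ^ 4)) x := by
  have hp := sq_add_sqrt_two_mul_add_one_pos x
  have hm := sq_sub_sqrt_two_mul_add_one_pos x
  have hs : √2 ^ 2 = (2 : ℝ) := Real.sq_sqrt zero_le_two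
  have hs0 : √2 ≠ (0 : ℝ) := by positivity
  have hl : HasDerivAt (fun x : ℝ => √2 * x) √2 x := by
    simpa using (hasDerivAt_id x).const_mul √2
  have hq : HasDerivAt (fun x : ℝ => x ^ 2) (2 * x) x := by
    simpa using hasDerivAt_pow 2 x
  have h := (((((hq.add hl).add_const 1).log hp.ne').sub
    (((hq.sub hl).add_const 1).log hm.ne')).add
    (((hl.add_const 1).arctan.add (hl.sub_const 1).arctan).const_mul 2)).div_const (4 * √2)
  refine h.congr_deriv ?_
  have e1 : 1 + (√2 * x + 1) ^ 2 = 2 * (x ^ 2 + √2 * x + 1) := by linear_combination x ^ 2 * hs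
  have e2 : 1 + (√2 * x - 1) ^ 2 = 2 * (x ^ 2 - √2 * x + 1) := by linear_combination x ^ 2 * hs
  have e3 : 1 + x ^ 4 = (x ^ 2 + √2 * x + 1) * (x ^ 2 - √2 * x + 1) := by
    linear_combination x ^ 2 * hs
  simp only [Pi.add_apply, Pi.sub_apply]
  rw [e1, e2, e3]
  have hp' := hp.ne'
  have hm' := hm.ne'
  generalize hP : x ^ 2 + √2 * x + 1 = P at *
  generalize hM : x ^ 2 - √2 * x + 1 = M at *
  field_simp
  rw [← hP, ← hM]
  ring

lemma integral_one_div_one_add_pow_four :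
    ∫ x in (0 : ℝ)..1, 1 / (1 + x ^ 4) = (π + log (3 + 2 * √2)) / (4 * √2) := by
  have hs : √2 ^ 2 = (2 : ℝ) := Real.sq_sqrt zero_le_two
  have hp := sq_add_sqrt_two_mul_add_one_pos 1
  have hm := sq_sub_sqrt_two_mul_add_one_pos 1
  rw [intervalIntegral.integral_eq_sub_of_hasDerivAt
    (fun x _ => hasDerivAt_antideriv_one_div_one_add_pow_four x)
    (by simpa using intervalIntegrable_pow_div_one_add_pow_four 0 0 1)]
  have hlog : log (1 ^ 2 + √2 * 1 + 1) - log (1 ^ 2 - √2 * 1 + 1) = log (3 + 2 * √2) := by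
    rw [← log_div hp.ne' hm.ne']
    congr 1
    rw [div_eq_iff hm.ne']
    linear_combination 2 * hs
  have hinv : √2 * 1 - 1 = (√2 * 1 + 1)⁻¹ := by
    refine eq_inv_of_mul_eq_one_left ?_
    linear_combination hs
  have harctan : arctan (√2 * 1 + 1) + arctan (√2 * 1 - 1) = π / 2 := by
    rw [hinv, arctan_inv_of_pos (by positivity)]
    ring
  rw [hlog, harctan]
  simp
  ring

theorem sum_grouped_mod_eight_eq :
    HasSum (fun n : ℕ => 1 / (8 * ((n : ℝ) + 1) - 7) - 1 / (8 * ((n : ℝ) + 1) - 3))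
      ((Real.pi + Real.log (3 + 2 * Real.sqrt 2)) / (4 * Real.sqrt 2)) := by
  set J : ℕ → ℝ := fun k => ∫ x in (0 : ℝ)..1, x ^ k / (1 + x ^ 4) with hJ
  have hterm (n : ℕ) : 1 / (8 * ((n : ℝ) + 1) - 7) - 1 / (8 * ((n : ℝ) + 1) - 3) =
      J (8 * n) - J (8 * (n + 1)) := by
    simp only [hJ]
    rw [show 8 * (n + 1) = 8 * n + 8 by ring, integral_pow_div_one_add_pow_four_sub]
    push_cast
    ring_nf
  have hJ0 : J 0 = (π + log (3 + 2 * √2)) / (4 * √2) := by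
    simpa [hJ] using integral_one_div_one_add_pow_four
  rw [hasSum_iff_tendsto_nat_of_nonneg]
  · simp_rw [hterm, Finset.sum_range_sub' (fun n => J (8 * n)), mul_zero, hJ0]
    have hlim : Filter.Tendsto (fun n : ℕ => J (8 * n)) Filter.atTop (nhds 0) := by
      refine squeeze_zero (fun n => integral_pow_div_one_add_pow_four_nonneg _) (fun n => ?_)
        tendsto_one_div_add_atTop_nhds_zero_nat
      refine (integral_pow_div_one_add_pow_four_le _).trans ?_
      gcongr
      omega
    simpa using hlim.const_sub ((π + log (3 + 2 * √2)) / (4 * √2))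
  · intro n
    have hn : (0 : ℝ) ≤ n := n.cast_nonneg
    exact sub_nonneg.2 (one_div_le_one_div_of_le (by linarith) (by linarith))
end
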